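/- (Hypergeometric representation of the monic Jacobi polynomial.) For every n ≥ 0 and all real x, Pₙ(x) = [(−2)ⁿ (β+1)ₙ / (α+β+n+1)ₙ] · Σ_{k=0}^{n} [(−n)ₖ (n+α+β+1)ₖ / ((β+1)ₖ · k!)] · ((1+x)/2)ᵏ, where (x)ₖ denotes the rising factorial x(x+1)⋯(x+k−1). -/

import Mathlib

open MeasureTheory Polynomial

lemma jac_w_int (α β : ℝ) (hα : -1 < α) (hβ : -1 < β) :
    IntervalIntegrable (fun x : ℝ => (1 - x) ^ α * (1 + x) ^ β) volume (-1) 1 := by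
  have h1 : IntervalIntegrable (fun x : ℝ => (1 + x) ^ β) volume (-1) 0 := by
    have h := (intervalIntegral.intervalIntegrable_rpow' (a := 0) (b := 1) hβ).comp_add_left 1
    simpa using h
  have h2 : IntervalIntegrable (fun x : ℝ => (1 - x) ^ α) volume 0 1 := by
    have h := (intervalIntegral.intervalIntegrable_rpow' (a := 1) (b := 0) hα).comp_sub_left 1
    simpa using h
  refine IntervalIntegrable.trans (b := 0) ?_ ?_
  · refine h1.continuousOn_mul ?_
    rw [Set.uIcc_of_le (by norm_num)]
    intro x hx
    refine ContinuousAt.continuousWithinAt ?_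
    refine ContinuousAt.rpow_const (by fun_prop) (Or.inl ?_)
    have := hx.2
    linarith
  · refine h2.mul_continuousOn ?_
    rw [Set.uIcc_of_le (by norm_num)]
    intro x hx
    refine ContinuousAt.continuousWithinAt ?_
    refine ContinuousAt.rpow_const (by fun_prop) (Or.inl ?_)
    have := hx.1
    linarith

lemma jac_int (α β : ℝ) (hα : -1 < α) (hβ : -1 < β) (p : ℝ[X]) :
    IntervalIntegrable (fun x : ℝ => p.eval x * ((1 - x) ^ α * (1 + x) ^ β)) volume (-1) 1 :=
  (jac_w_int α β hα hβ).continuousOn_mul p.continuous.continuousOn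

noncomputable def jacL (α β : ℝ) (p : ℝ[X]) : ℝ :=
  ∫ x in (-1 : ℝ)..1, p.eval x * ((1 - x) ^ α * (1 + x) ^ β)

lemma jacL_add (α β : ℝ) (hα : -1 < α) (hβ : -1 < β) (p q : ℝ[X]) :
    jacL α β (p + q) = jacL α β p + jacL α β q := by
  unfold jacL
  rw [← intervalIntegral.integral_add (jac_int α β hα hβ p) (jac_int α β hα hβ q)]
  simp only [eval_add, add_mul]

lemma jacL_smul (α β : ℝ) (c : ℝ) (p : ℝ[X]) :
    jacL α β (C c * p) = c * jacL α β p := by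
  unfold jacL
  rw [← intervalIntegral.integral_const_mul]
  simp only [eval_mul, eval_C, mul_assoc]

lemma jacL_deriv (α β : ℝ) (hα : -1 < α) (hβ : -1 < β) (p : ℝ[X]) :
    jacL α β ((1 - X ^ 2) * derivative p + (C (β - α) - C (α + β + 2) * X) * p) = 0 := by
  unfold jacL
  have key := intervalIntegral.integral_eq_sub_of_hasDerivAt_of_le (a := (-1 : ℝ)) (b := 1)
    (f := fun x : ℝ => ((1 - x) ^ (α + 1) * (1 + x) ^ (β + 1)) * p.eval x)
    (f' := fun x : ℝ =>
      ((1 - X ^ 2) * derivative p + (C (β - α) - C (α + β + 2) * X) * p).eval x *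
        ((1 - x) ^ α * (1 + x) ^ β)) (by norm_num) ?_ ?_ (jac_int α β hα hβ _)
  · rw [key]
    simp [Real.zero_rpow (by linarith : α + 1 ≠ 0), Real.zero_rpow (by linarith : β + 1 ≠ 0)]
  · refine Continuous.continuousOn ?_
    refine Continuous.mul (Continuous.mul ?_ ?_) p.continuous
    · exact Continuous.rpow_const (by fun_prop) (fun x => Or.inr (by linarith))
    · exact Continuous.rpow_const (by fun_prop) (fun x => Or.inr (by linarith))
  · intro x hx
    have hx1 : 0 < 1 - x := by linarith [hx.2]
    have hx2 : 0 < 1 + x := by linarith [hx.1]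
    have d1 : HasDerivAt (fun x : ℝ => (1 - x) ^ (α + 1)) (-1 * (α + 1) * (1 - x) ^ α) x := by
      have := ((hasDerivAt_id x).const_sub 1).rpow_const (p := α + 1) (Or.inl hx1.ne')
      simpa using this
    have d2 : HasDerivAt (fun x : ℝ => (1 + x) ^ (β + 1)) (1 * (β + 1) * (1 + x) ^ β) x := by
      have := ((hasDerivAt_id x).const_add 1).rpow_const (p := β + 1) (Or.inl hx2.ne')
      simpa using this
    have d := (d1.mul d2).mul (p.hasDerivAt x)
    refine d.congr_deriv ?_
    simp only [Pi.mul_apply, Real.rpow_add_one hx1.ne', Real.rpow_add_one hx2.ne']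
    simp only [eval_add, eval_mul, eval_sub, eval_one, eval_pow, eval_X, eval_C]
    ring

/-- The Jacobi differential operator. -/
noncomputable def jacD (α β : ℝ) (f : ℝ[X]) : ℝ[X] :=
  (1 - X ^ 2) * derivative (derivative f) + (C (β - α) - C (α + β + 2) * X) * derivative f

lemma jacL_symm (α β : ℝ) (hα : -1 < α) (hβ : -1 < β) (f g : ℝ[X]) :
    jacL α β (jacD α β f * g) = jacL α β (f * jacD α β g) := by
  have h1 := jacL_deriv α β hα hβ (derivative f * g)
  have h2 := jacL_deriv α β hα hβ (derivative g * f)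
  have e1 : (1 - X ^ 2) * derivative (derivative f * g) +
      (C (β - α) - C (α + β + 2) * X) * (derivative f * g)
      = jacD α β f * g + (1 - X ^ 2) * (derivative f * derivative g) := by
    simp only [jacD, derivative_mul]; ring
  have e2 : (1 - X ^ 2) * derivative (derivative g * f) +
      (C (β - α) - C (α + β + 2) * X) * (derivative g * f)
      = f * jacD α β g + (1 - X ^ 2) * (derivative f * derivative g) := by
    simp only [jacD, derivative_mul]; ring
  rw [e1, jacL_add α β hα hβ] at h1
  rw [e2, jacL_add α β hα hβ] at h2
  linarith

lemma jacL_sq (α β : ℝ) (hα : -1 < α) (hβ : -1 < β) (r : ℝ[X])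
    (h : jacL α β (r * r) = 0) : r = 0 := by
  by_contra hr
  have hpos : 0 < jacL α β (r * r) := by
    unfold jacL
    rw [intervalIntegral.integral_pos_iff_support_of_nonneg_ae' _ (jac_int α β hα hβ _)]
    · refine ⟨by norm_num, ?_⟩
      have hsub : Set.Ioo (-1 : ℝ) 1 \ (r.roots.toFinset : Set ℝ) ⊆
          (Function.support fun x : ℝ => (r * r).eval x * ((1 - x) ^ α * (1 + x) ^ β)) ∩
            Set.Ioc (-1) 1 := by
        rintro x ⟨hx, hxr⟩
        refine ⟨?_, hx.1, hx.2.le⟩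
        have hx1 : 0 < 1 - x := by linarith [hx.2]
        have hx2 : 0 < 1 + x := by linarith [hx.1]
        have hne : r.eval x ≠ 0 := by
          intro h0
          apply hxr
          simp [hr, h0]
        simp only [Function.mem_support, eval_mul]
        have := Real.rpow_pos_of_pos hx1 α
        have := Real.rpow_pos_of_pos hx2 β
        positivity
      refine lt_of_lt_of_le ?_ (measure_mono hsub)
      rw [measure_diff_null (Finset.measure_zero _ _)]
      simp
    · rw [Set.uIoc_of_le (by norm_num)]
      refine (ae_restrict_iff' measurableSet_Ioc).2 (Filter.Eventually.of_forall ?_)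
      intro x hx
      have hx1 : 0 ≤ 1 - x := by linarith [hx.2]
      have hx2 : 0 ≤ 1 + x := by linarith [hx.1]
      simp only [Pi.zero_apply, eval_mul]
      have := Real.rpow_nonneg hx1 α
      have := Real.rpow_nonneg hx2 β
      have := mul_self_nonneg (r.eval x)
      positivity
  exact hpos.ne' h

lemma jacL_orth (α β : ℝ) (hα : -1 < α) (hβ : -1 < β)
    (P : ℕ → Polynomial ℝ)
    (hmonic : ∀ n, (P n).Monic) (hdeg : ∀ n, (P n).natDegree = n)
    (horth : ∀ m n : ℕ, m ≠ n → jacL α β (P m * P n) = 0) (n : ℕ) :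
    ∀ d : ℕ, d ≤ n → ∀ q : ℝ[X], (∀ k, d ≤ k → q.coeff k = 0) → jacL α β (P n * q) = 0 := by
  intro d
  induction d with
  | zero =>
    intro _ q hq
    have : q = 0 := by ext k; simp [hq k (Nat.zero_le k)]
    simp [this, jacL]
  | succ d ih =>
    intro hd q hq
    have e : P n * q = P n * (q - C (q.coeff d) * P d) + C (q.coeff d) * (P n * P d) := by ring
    rw [e, jacL_add α β hα hβ, jacL_smul, horth n d (by omega), ih (by omega)]
    · simp
    · intro k hk
      rcases hk.eq_or_lt with rfl | hk
      · have : (P d).coeff d = 1 := by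
          have := (hmonic d).coeff_natDegree
          rwa [hdeg] at this
        simp [this]
      · have : (P d).coeff k = 0 := coeff_eq_zero_of_natDegree_lt (by rw [hdeg]; exact hk)
        simp [this, hq k hk]

lemma jacD_coeff (α β : ℝ) (f : ℝ[X]) (k : ℕ) :
    (jacD α β f).coeff k = ((k : ℝ) + 2) * (k + 1) * f.coeff (k + 2)
      + (β - α) * (k + 1) * f.coeff (k + 1) - k * (k + α + β + 1) * f.coeff k := by
  have e : jacD α β f = derivative (derivative f) - X * (X * derivative (derivative f))
    + C (β - α) * derivative f - C (α + β + 2) * (X * derivative f) := by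
    unfold jacD; ring
  rw [e]
  simp only [coeff_sub, coeff_add, coeff_C_mul]
  rcases k with _ | _ | k
  · simp [coeff_derivative]; ring
  · simp [coeff_derivative, coeff_X_mul]; ring
  · simp [coeff_derivative, coeff_X_mul]; ring

lemma jac_eigen (α β : ℝ) (hα : -1 < α) (hβ : -1 < β)
    (P : ℕ → Polynomial ℝ)
    (hmonic : ∀ n, (P n).Monic) (hdeg : ∀ n, (P n).natDegree = n)
    (horth : ∀ m n : ℕ, m ≠ n → jacL α β (P m * P n) = 0) (n : ℕ) :
    jacD α β (P n) + C ((n : ℝ) * (n + α + β + 1)) * P n = 0 := by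
  set R := jacD α β (P n) + C ((n : ℝ) * (n + α + β + 1)) * P n with hR
  have hz : ∀ k, n < k → (P n).coeff k = 0 := fun k hk =>
    coeff_eq_zero_of_natDegree_lt (by rw [hdeg]; exact hk)
  have hRc : ∀ k, n ≤ k → R.coeff k = 0 := by
    intro k hk
    rw [hR, coeff_add, coeff_C_mul, jacD_coeff, hz (k + 2) (by omega), hz (k + 1) (by omega)]
    rcases hk.eq_or_lt with rfl | hk
    · ring
    · rw [hz k hk]; ring
  apply jacL_sq α β hα hβ
  have e : R * R = jacD α β (P n) * R + C ((n : ℝ) * (n + α + β + 1)) * (P n * R) := by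
    rw [hR]; ring
  rw [e, jacL_add α β hα hβ, jacL_smul, jacL_symm α β hα hβ,
    jacL_orth α β hα hβ P hmonic hdeg horth n n le_rfl R hRc,
    jacL_orth α β hα hβ P hmonic hdeg horth n n le_rfl]
  · simp
  · intro k hk
    rw [jacD_coeff, hRc k hk, hRc (k + 1) (by omega), hRc (k + 2) (by omega)]; ring

lemma jac_poch_neg (n : ℕ) : (ascPochhammer ℝ n).eval (-(n : ℝ)) = (-1) ^ n * n.factorial := by
  rw [ascPochhammer_eval_neg_eq_descPochhammer, ← Nat.descFactorial_self,
    descPochhammer_eval_eq_descFactorial]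

/-- Hypergeometric representation of the monic Jacobi polynomial:
for every `n ≥ 0` and all real `x`,
`Pₙ(x) = [(-2)ⁿ (β+1)ₙ / (α+β+n+1)ₙ] ·
  Σ_{k=0}^{n} [(-n)ₖ (n+α+β+1)ₖ / ((β+1)ₖ k!)] ((1+x)/2)ᵏ`,
where `(x)ₖ` is the rising factorial. -/
theorem jacobi_hypergeometric_representation
    (α β : ℝ) (hα : -1 < α) (hβ : -1 < β)
    (P : ℕ → Polynomial ℝ)
    (hmonic : ∀ n, (P n).Monic) (hdeg : ∀ n, (P n).natDegree = n)
    (horth : ∀ m n : ℕ, m ≠ n →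
      ∫ x in (-1 : ℝ)..1, (P m).eval x * (P n).eval x * ((1 - x) ^ α * (1 + x) ^ β) = 0) :
    ∀ n : ℕ, ∀ x : ℝ,
      (P n).eval x
        = ((-2 : ℝ) ^ n * (ascPochhammer ℝ n).eval (β + 1) /
            (ascPochhammer ℝ n).eval (α + β + (n : ℝ) + 1)) *
          ∑ k ∈ Finset.range (n + 1),
            ((ascPochhammer ℝ k).eval (-(n : ℝ)) *
              (ascPochhammer ℝ k).eval ((n : ℝ) + α + β + 1) /
              ((ascPochhammer ℝ k).eval (β + 1) * (k.factorial : ℝ))) *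
            ((1 + x) / 2) ^ k := by
  intro n x
  have horth' : ∀ m n : ℕ, m ≠ n → jacL α β (P m * P n) = 0 := by
    intro m n h
    have := horth m n h
    simpa only [jacL, eval_mul] using this
  have hE := jac_eigen α β hα hβ P hmonic hdeg horth' n
  obtain ⟨p, hp⟩ : ∃ p, p = (P n).comp (C 2 * X - 1) := ⟨_, rfl⟩
  have hd1 : derivative p = C 2 * (derivative (P n)).comp (C 2 * X - 1) := by
    rw [hp, derivative_comp]; simp
  have hd2 : derivative (derivative p) =
      C 4 * (derivative (derivative (P n))).comp (C 2 * X - 1) := by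
    rw [hd1, derivative_C_mul, derivative_comp]
    have : (C 4 : ℝ[X]) = C 2 * C 2 := by rw [← C_mul]; norm_num
    rw [this]; simp; ring
  have hnd : p.natDegree = n := by
    have : (C 2 * X - 1 : ℝ[X]).natDegree = 1 := by
      have := natDegree_linear (R := ℝ) (a := 2) (b := -1) (by norm_num)
      simpa [sub_eq_add_neg] using this
    rw [hp, natDegree_comp, hdeg, this, mul_one]
  have hlc : p.coeff n = 2 ^ n := by
    have h1 : (C 2 * X - 1 : ℝ[X]).natDegree = 1 := by
      have := natDegree_linear (R := ℝ) (a := 2) (b := -1) (by norm_num)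
      simpa [sub_eq_add_neg] using this
    have h2 : (C 2 * X - 1 : ℝ[X]).leadingCoeff = 2 := by
      rw [leadingCoeff, h1]; simp [coeff_one]
    have h3 := leadingCoeff_comp (p := P n) (q := (C 2 * X - 1 : ℝ[X])) (by rw [h1]; norm_num)
    rw [← hp, leadingCoeff, hnd, h2, hdeg, (hmonic n).leadingCoeff, one_mul] at h3
    exact h3
  have hode : derivative (derivative p) * X - X * (X * derivative (derivative p))
      + C (β + 1) * derivative p - C (α + β + 2) * (X * derivative p)
      + C ((n : ℝ) * (n + α + β + 1)) * p = 0 := by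
    have h := congrArg (fun q : ℝ[X] => q.comp (C 2 * X - 1)) hE
    simp only [jacD, add_comp, mul_comp, sub_comp, C_comp, X_comp, pow_comp, one_comp,
      zero_comp, ← hp] at h
    rw [← h, hd2, hd1]
    apply Polynomial.funext
    intro y
    simp only [eval_add, eval_sub, eval_mul, eval_C, eval_X, eval_one, eval_pow]
    ring
  have hrec : ∀ k : ℕ, ((k : ℝ) + 1) * (k + β + 1) * p.coeff (k + 1)
      = (k - n) * (k + n + α + β + 1) * p.coeff k := by
    intro k
    have h := congrArg (fun q : ℝ[X] => q.coeff k) hode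
    simp only [coeff_sub, coeff_add, coeff_C_mul, coeff_zero] at h
    rcases k with _ | _ | k
    · simp [coeff_derivative] at h ⊢; linarith
    · simp [coeff_derivative, coeff_X_mul, coeff_mul_X] at h ⊢; linarith
    · simp [coeff_derivative, coeff_X_mul, coeff_mul_X] at h ⊢; linarith
  have hposb : ∀ k : ℕ, 0 < (ascPochhammer ℝ k).eval (β + 1) := fun k =>
    ascPochhammer_pos k _ (by linarith)
  have hc : ∀ k : ℕ, p.coeff k = p.coeff 0 * ((ascPochhammer ℝ k).eval (-(n : ℝ)) *
      (ascPochhammer ℝ k).eval ((n : ℝ) + α + β + 1) /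
      ((ascPochhammer ℝ k).eval (β + 1) * (k.factorial : ℝ))) := by
    intro k
    induction k with
    | zero => simp
    | succ k ih =>
      have h := hrec k
      rw [ih] at h
      have hb : 0 < (k : ℝ) + β + 1 := by
        have : (0 : ℝ) ≤ k := Nat.cast_nonneg k
        linarith
      have hk : (0 : ℝ) < (k : ℝ) + 1 := by positivity
      have hb1 := hposb k
      have hf : (0 : ℝ) < k.factorial := by exact_mod_cast k.factorial_pos
      have hb' : 0 < β + 1 + (k : ℝ) := by linarith
      simp only [ascPochhammer_succ_eval, Nat.factorial_succ]
      push_cast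
      have hm : ((k : ℝ) + 1) * (k + β + 1) ≠ 0 := by positivity
      apply mul_left_cancel₀ hm
      rw [h]
      field_simp
      ring
  have hposn : 0 < (ascPochhammer ℝ n).eval ((n : ℝ) + α + β + 1) := by
    rcases Nat.eq_zero_or_pos n with rfl | hn
    · simp
    · have : (1 : ℝ) ≤ n := by exact_mod_cast hn
      exact ascPochhammer_pos n _ (by linarith)
  have hA : p.coeff 0 = (-2 : ℝ) ^ n * (ascPochhammer ℝ n).eval (β + 1) /
            (ascPochhammer ℝ n).eval (α + β + (n : ℝ) + 1) := by
    have h := hc n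
    have e : α + β + (n : ℝ) + 1 = (n : ℝ) + α + β + 1 := by ring
    rw [hlc, jac_poch_neg] at h
    rw [e, eq_div_iff hposn.ne']
    have hf : (0 : ℝ) < n.factorial := by exact_mod_cast n.factorial_pos
    have hb := hposb n
    rw [eq_comm, ← mul_div_assoc, div_eq_iff (by positivity)] at h
    have hs : ((-1 : ℝ) ^ n) * (-1) ^ n = 1 := by rw [← mul_pow]; norm_num
    have h2 : (-2 : ℝ) ^ n = (-1) ^ n * 2 ^ n := by rw [← mul_pow]; norm_num
    rw [h2]
    apply mul_right_cancel₀ hf.ne'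
    linear_combination (-1 : ℝ) ^ n * h - p.coeff 0 *
      (ascPochhammer ℝ n).eval ((n : ℝ) + α + β + 1) * n.factorial * hs
  have hev : (P n).eval x = p.eval ((1 + x) / 2) := by
    rw [hp, eval_comp]; congr 1; simp; ring
  rw [hev, eval_eq_sum_range, hnd, ← hA, Finset.mul_sum]
  refine Finset.sum_congr rfl fun k _ => ?_
  rw [hc k]; ring
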